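/- Let S = (x_1, …, x_n) be a finite population of n real numbers all lying in [0,1], and let Y = (y_1, …, y_r) be a sample of size r (1 ≤ r ≤ n) drawn from S uniformly at random without replacement. Let σ ≥ 0 denote the population standard deviation (σ² = (1/n) Σ_{i=1}^n (x_i − x̄)² with x̄ the population mean) and σ̂ ≥ 0 the sample standard deviation (σ̂² = (1/r) Σ_{i=1}^r (y_i − ȳ)² with ȳ the sample mean). Then there is an absolute constant C > 0 such that for every δ ∈ (0,1/2), with probability at least 1 − 2δ, |σ − σ̂| ≤ C · sqrt(log(3/δ) / (2r)). -/

import Mathlib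

open Finset in
lemma perm_prod_aux {n : ℕ} (w : Fin n → ℝ) (hw : ∀ i, 0 ≤ w i) (T : Finset (Fin n)) :
    (n : ℝ) ^ T.card * ∑ p : Equiv.Perm (Fin n), ∏ i ∈ T, w (p i) ≤
      (Fintype.card (Equiv.Perm (Fin n)) : ℝ) * (∑ i, w i) ^ T.card := by
  classical
  induction T using Finset.induction_on with
  | empty => simp
  | insert a T ha ih =>
    have key : ∀ j, ∑ p : Equiv.Perm (Fin n), ∏ i ∈ insert a T, w (p i) ≤
        ∑ p : Equiv.Perm (Fin n), (∏ i ∈ T, w (p i)) * w (p j) := by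
      intro j
      by_cases hj : j ∈ T
      · have hT : ∀ p : Equiv.Perm (Fin n), ∏ i ∈ T, w (p i) =
            w (p j) * ∏ i ∈ T.erase j, w (p i) := fun p => (Finset.mul_prod_erase T _ hj).symm
        have hsw : ∑ p : Equiv.Perm (Fin n), (∏ i ∈ T, w (p i)) * w (p j) =
            ∑ p : Equiv.Perm (Fin n), (∏ i ∈ T.erase j, w (p i)) * w (p a) ^ 2 := by
          rw [← Equiv.sum_comp (Equiv.mulRight (Equiv.swap a j))]
          refine Finset.sum_congr rfl fun p _ => ?_
          rw [hT]
          have : ∏ i ∈ T.erase j, w ((Equiv.mulRight (Equiv.swap a j) p) i) =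
              ∏ i ∈ T.erase j, w (p i) := by
            refine Finset.prod_congr rfl fun i hi => ?_
            have h1 : i ≠ j := Finset.ne_of_mem_erase hi
            have h2 : i ≠ a := fun h => ha (h ▸ Finset.mem_of_mem_erase hi)
            simp [Equiv.swap_apply_of_ne_of_ne h2 h1]
          rw [this]
          simp
          ring
        have h2 : 2 * ∑ p : Equiv.Perm (Fin n), ∏ i ∈ insert a T, w (p i) ≤
            ∑ p : Equiv.Perm (Fin n), (∏ i ∈ T, w (p i)) * w (p j) +
            ∑ p : Equiv.Perm (Fin n), (∏ i ∈ T.erase j, w (p i)) * w (p a) ^ 2 := by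
          rw [Finset.mul_sum, ← Finset.sum_add_distrib]
          refine Finset.sum_le_sum fun p _ => ?_
          rw [Finset.prod_insert ha, hT]
          have : 0 ≤ ∏ i ∈ T.erase j, w (p i) := Finset.prod_nonneg fun i _ => hw _
          nlinarith [mul_nonneg this (sq_nonneg (w (p a) - w (p j)))]
        linarith
      · apply le_of_eq
        rw [← Equiv.sum_comp (Equiv.mulRight (Equiv.swap a j))]
        refine Finset.sum_congr rfl fun p _ => ?_
        rw [Finset.prod_insert ha]
        have : ∏ i ∈ T, w ((Equiv.mulRight (Equiv.swap a j) p) i) = ∏ i ∈ T, w (p i) := by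
          refine Finset.prod_congr rfl fun i hi => ?_
          have h1 : i ≠ j := fun h => hj (h ▸ hi)
          have h2 : i ≠ a := fun h => ha (h ▸ hi)
          simp [Equiv.swap_apply_of_ne_of_ne h2 h1]
        rw [this]
        simp
        ring
    have hsum : (n : ℝ) * ∑ p : Equiv.Perm (Fin n), ∏ i ∈ insert a T, w (p i) ≤
        (∑ i, w i) * ∑ p : Equiv.Perm (Fin n), ∏ i ∈ T, w (p i) := by
      calc _ = ∑ j : Fin n, ∑ p : Equiv.Perm (Fin n), ∏ i ∈ insert a T, w (p i) := by simp
        _ ≤ ∑ j : Fin n, ∑ p : Equiv.Perm (Fin n), (∏ i ∈ T, w (p i)) * w (p j) :=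
          Finset.sum_le_sum fun j _ => key j
        _ = _ := by
          rw [Finset.sum_comm, Finset.mul_sum]
          refine Finset.sum_congr rfl fun p _ => ?_
          rw [← Finset.mul_sum, Equiv.sum_comp p w, mul_comm]
    rw [Finset.card_insert_of_notMem ha, pow_succ, pow_succ, mul_assoc]
    have hS : 0 ≤ ∑ i, w i := Finset.sum_nonneg fun i _ => hw i
    calc _ ≤ (n : ℝ) ^ T.card * ((∑ i, w i) * ∑ p : Equiv.Perm (Fin n), ∏ i ∈ T, w (p i)) := by
          gcongr
      _ = (∑ i, w i) * ((n : ℝ) ^ T.card * ∑ p : Equiv.Perm (Fin n), ∏ i ∈ T, w (p i)) := by ring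
      _ ≤ (∑ i, w i) * ((Fintype.card (Equiv.Perm (Fin n)) : ℝ) * (∑ i, w i) ^ T.card) := by
          gcongr
      _ = _ := by ring

lemma emb_prod_le {n r : ℕ} (hn : 0 < n) (w : Fin n → ℝ) (hw : ∀ i, 0 ≤ w i) :
    ∑ f : Fin r ↪ Fin n, ∏ i, w (f i) ≤
      (Fintype.card (Fin r ↪ Fin n) : ℝ) * (1 / (n : ℝ) * ∑ i, w i) ^ r := by
  classical
  have hP : (0 : ℝ) < Fintype.card (Equiv.Perm (Fin n)) := by exact_mod_cast Fintype.card_pos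
  have h1 : (Fintype.card (Equiv.Perm (Fin n)) : ℝ) * ∑ f : Fin r ↪ Fin n, ∏ i, w (f i) =
      ∑ f : Fin r ↪ Fin n, ∑ p : Equiv.Perm (Fin n), ∏ i, w (p (f i)) := by
    rw [Finset.sum_comm]
    have : ∀ p : Equiv.Perm (Fin n), ∑ f : Fin r ↪ Fin n, ∏ i, w (p (f i)) =
        ∑ f : Fin r ↪ Fin n, ∏ i, w (f i) := by
      intro p
      exact Equiv.sum_comp (Equiv.embeddingCongr (Equiv.refl (Fin r)) p)
        (fun f : Fin r ↪ Fin n => ∏ i, w (f i))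
    simp [this]
  have h2 : ∀ f : Fin r ↪ Fin n, ∑ p : Equiv.Perm (Fin n), ∏ i, w (p (f i)) ≤
      (Fintype.card (Equiv.Perm (Fin n)) : ℝ) * (1 / (n : ℝ) * ∑ i, w i) ^ r := by
    intro f
    have := perm_prod_aux w hw (Finset.univ.map f)
    simp only [Finset.prod_map, Finset.card_map, Finset.card_univ, Fintype.card_fin] at this
    have hn' : (0 : ℝ) < n ^ r := by positivity
    rw [mul_pow, div_pow, one_pow]
    rw [mul_comm, ← le_div_iff₀ hn'] at this
    calc _ ≤ _ := this
      _ = _ := by ring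
  have h3 := Finset.sum_le_sum fun (f : Fin r ↪ Fin n) (_ : f ∈ Finset.univ) => h2 f
  rw [← h1] at h3
  simp only [Finset.sum_const, Finset.card_univ, nsmul_eq_mul] at h3
  refine le_of_mul_le_mul_left ?_ hP
  calc _ ≤ _ := h3
    _ = _ := by ring

lemma tail_aux {n r : ℕ} (hn : 0 < n) (g : Fin n → ℝ) (hg : ∀ i, |g i| ≤ 1) (m v s : ℝ)
    (hm : 1 / (n : ℝ) * ∑ i, g i ≤ m) (hv : 1 / (n : ℝ) * ∑ i, g i ^ 2 ≤ v)
    (B : Finset (Fin r ↪ Fin n)) (hB : ∀ f ∈ B, (r : ℝ) * (m + v + s) ≤ ∑ i, g (f i)) :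
    (B.card : ℝ) ≤ Fintype.card (Fin r ↪ Fin n) * Real.exp (-(r * s)) := by
  have h1 := emb_prod_le (r := r) hn (fun i => Real.exp (g i)) (fun i => (Real.exp_pos _).le)
  have h2 : 1 / (n : ℝ) * ∑ i, Real.exp (g i) ≤ Real.exp (m + v) := by
    calc _ ≤ 1 / (n : ℝ) * ∑ i, (1 + g i + g i ^ 2) := by
          gcongr with i
          have := Real.abs_exp_sub_one_sub_id_le (hg i)
          linarith [le_abs_self (Real.exp (g i) - 1 - g i)]
      _ = 1 + 1 / (n : ℝ) * ∑ i, g i + 1 / (n : ℝ) * ∑ i, g i ^ 2 := by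
          simp only [Finset.sum_add_distrib, Finset.sum_const, Finset.card_univ, Fintype.card_fin]
          have : (n : ℝ) ≠ 0 := by positivity
          simp
          field_simp
      _ ≤ m + v + 1 := by linarith
      _ ≤ _ := Real.add_one_le_exp _
  have h3 : (B.card : ℝ) * Real.exp (r * (m + v + s)) ≤
      ∑ f : Fin r ↪ Fin n, ∏ i, Real.exp (g (f i)) := by
    calc _ = ∑ f ∈ B, Real.exp (r * (m + v + s)) := by simp
      _ ≤ ∑ f ∈ B, ∏ i, Real.exp (g (f i)) := by
          refine Finset.sum_le_sum fun f hf => ?_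
          rw [← Real.exp_sum]
          exact Real.exp_le_exp.2 (hB f hf)
      _ ≤ _ := Finset.sum_le_sum_of_subset_of_nonneg (Finset.subset_univ _)
          fun f _ _ => Finset.prod_nonneg fun i _ => (Real.exp_pos _).le
  have h4 : (1 / (n : ℝ) * ∑ i, Real.exp (g i)) ^ r ≤ Real.exp (r * (m + v)) := by
    rw [Real.exp_nat_mul]
    gcongr
  refine le_of_mul_le_mul_right ?_ (Real.exp_pos (r * (m + v + s)))
  rw [mul_assoc, ← Real.exp_add]
  calc _ ≤ _ := h3
    _ ≤ _ := h1
    _ ≤ _ := by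
      gcongr
      refine h4.trans (le_of_eq ?_)
      congr 1
      ring

set_option maxHeartbeats 2000000 in
/-- the combined deviation bound -/
lemma bad_card {n r : ℕ} (hn : 0 < n) (hr : 0 < r) (x : Fin n → ℝ)
    (hx : ∀ i, x i ∈ Set.Icc (0 : ℝ) 1) (u μ σ : ℝ) (hu : 0 < u)
    (hμ : μ = 1 / (n : ℝ) * ∑ j, x j) (hσ0 : 0 ≤ σ)
    (hσ : σ ^ 2 = 1 / (n : ℝ) * ∑ i, (x i - μ) ^ 2)
    (B : Finset (Fin r ↪ Fin n))
    (hB : ∀ f ∈ B, 2 * u < |σ - Real.sqrt ((1 / (r : ℝ)) *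
                      ∑ i, (x (f i) - (1 / (r : ℝ)) * ∑ j, x (f j)) ^ 2)|) :
    (B.card : ℝ) ≤ 4 * (Fintype.card (Fin r ↪ Fin n) * Real.exp (-(r * (u ^ 2 / 4)))) := by
  classical
  have hn' : (0 : ℝ) < n := by exact_mod_cast hn
  have hr' : (0 : ℝ) < r := by exact_mod_cast hr
  have hμ0 : 0 ≤ μ := by
    rw [hμ]; exact mul_nonneg (by positivity) (Finset.sum_nonneg fun i _ => (hx i).1)
  have hμ1 : μ ≤ 1 := by
    rw [hμ]
    have : ∑ j, x j ≤ ∑ j : Fin n, (1 : ℝ) := Finset.sum_le_sum fun i _ => (hx i).2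
    simp at this
    rw [one_div, inv_mul_le_iff₀ hn']; linarith
  have hd : ∀ i, |x i - μ| ≤ 1 := fun i => abs_le.2 ⟨by linarith [(hx i).1], by linarith [(hx i).2]⟩
  have hd2 : ∀ i, (x i - μ) ^ 2 ≤ 1 := fun i => by
    rw [← sq_abs]; exact pow_le_one₀ (abs_nonneg _) (hd i)
  have hmean0 : ∑ i, (x i - μ) = 0 := by
    rw [Finset.sum_sub_distrib]; simp; rw [hμ]; field_simp; simp
  have hσ1 : σ ^ 2 ≤ 1 := by
    rw [hσ]
    have : ∑ i, (x i - μ) ^ 2 ≤ ∑ j : Fin n, (1 : ℝ) := Finset.sum_le_sum fun i _ => hd2 i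
    simp at this
    rw [one_div, inv_mul_le_iff₀ hn']; linarith
  have h4 : 1 / (n : ℝ) * ∑ i, ((x i - μ) ^ 2) ^ 2 ≤ σ ^ 2 := by
    rw [hσ]
    refine mul_le_mul_of_nonneg_left (Finset.sum_le_sum fun i _ => ?_) (by positivity)
    nlinarith [hd2 i, sq_nonneg (x i - μ)]
  set D : (Fin r ↪ Fin n) → ℝ := fun f => ∑ i, (x (f i) - μ) with hD
  set A : (Fin r ↪ Fin n) → ℝ := fun f => ∑ i, (x (f i) - μ) ^ 2 with hA
  set N : ℝ := (Fintype.card (Fin r ↪ Fin n) : ℝ) * Real.exp (-(r * (u ^ 2 / 4))) with hN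
  have hN0 : 0 ≤ N := by positivity
  have hDle : ∀ f, |D f| ≤ r := fun f => by
    calc |D f| ≤ ∑ i, |x (f i) - μ| := Finset.abs_sum_le_sum_abs _ _
      _ ≤ ∑ i : Fin r, (1 : ℝ) := Finset.sum_le_sum fun i _ => hd _
      _ = r := by simp
  have hA0 : ∀ f, 0 ≤ A f := fun f => Finset.sum_nonneg fun i _ => sq_nonneg _
  -- events 1 and 2
  have hE12 : ∀ ε : ℝ, |ε| = 1 →
      ((Finset.univ.filter fun f => r * u < ε * D f).card : ℝ) ≤ N := by
    intro ε hε
    by_cases hu1 : 1 ≤ u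
    · have : (Finset.univ.filter fun f => r * u < ε * D f) = ∅ := by
        refine Finset.filter_eq_empty_iff.2 fun f _ => ?_
        have h1 : ε * D f ≤ r := by
          calc ε * D f ≤ |ε * D f| := le_abs_self _
            _ = |D f| := by rw [abs_mul, hε, one_mul]
            _ ≤ r := hDle f
        nlinarith
      rw [this]; simpa using hN0
    · push Not at hu1
      have hε2 : ε ^ 2 = 1 := by rw [← sq_abs, hε]; norm_num
      refine tail_aux hn (fun i => (u / 2) * ε * (x i - μ)) (fun i => ?_) 0 (u ^ 2 / 4) (u ^ 2 / 4)
        ?_ ?_ _ ?_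
      · rw [abs_mul, abs_mul, hε, abs_of_pos (by positivity)]
        nlinarith [hd i, abs_nonneg (x i - μ)]
      · rw [← Finset.mul_sum, hmean0]; simp
      · have : ∑ i, ((u / 2) * ε * (x i - μ)) ^ 2 = u ^ 2 / 4 * ∑ i, (x i - μ) ^ 2 := by
          rw [Finset.mul_sum]
          refine Finset.sum_congr rfl fun i _ => ?_
          rw [mul_pow, mul_pow, hε2]; ring
        rw [this]
        calc _ = u ^ 2 / 4 * (1 / (n : ℝ) * ∑ i, (x i - μ) ^ 2) := by ring
          _ = u ^ 2 / 4 * σ ^ 2 := by rw [hσ]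
          _ ≤ _ := by nlinarith [sq_nonneg u]
      · intro f hf
        have hf := (Finset.mem_filter.1 hf).2
        rw [← Finset.mul_sum]
        change _ ≤ u / 2 * ε * D f
        nlinarith
  have hE3 : ((Finset.univ.filter fun f => r * (σ + u) ^ 2 < A f).card : ℝ) ≤ N := by
    obtain ⟨l, hl⟩ : ∃ l, l = u / (σ + u) := ⟨_, rfl⟩
    have hl0 : 0 < l := by rw [hl]; positivity
    have hl1 : l ≤ 1 := by rw [hl, div_le_one (by positivity)]; linarith
    have hlu : l * (σ + u) = u := by rw [hl]; field_simp
    refine tail_aux hn (fun i => l * (x i - μ) ^ 2) (fun i => ?_) (l * σ ^ 2) (l ^ 2 * σ ^ 2)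
      (u ^ 2 / 4) ?_ ?_ _ ?_
    · rw [abs_of_nonneg (by positivity)]
      nlinarith [hd2 i, sq_nonneg (x i - μ)]
    · rw [← Finset.mul_sum, hσ]; apply le_of_eq; ring
    · simp only [mul_pow]
      rw [← Finset.mul_sum]
      calc _ = l ^ 2 * (1 / (n : ℝ) * ∑ i, ((x i - μ) ^ 2) ^ 2) := by ring
        _ ≤ _ := by gcongr
    · intro f hf
      have hf := (Finset.mem_filter.1 hf).2
      rw [← Finset.mul_sum]
      change _ ≤ l * A f
      have h1 : l * σ ^ 2 + l ^ 2 * σ ^ 2 + u ^ 2 / 4 ≤ l * (σ + u) ^ 2 := by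
        have e1 : l * (σ + u) ^ 2 = u * (σ + u) := by rw [sq, ← mul_assoc, hlu]
        have e2 : l * σ = u - l * u := by linarith
        have e3 : l * σ ≤ u := by nlinarith
        have e4 : 0 ≤ l * σ := by positivity
        have e5 : l * σ ^ 2 = u * σ - u * (l * σ) := by linear_combination σ * e2
        have e6 : l ^ 2 * σ ^ 2 ≤ u * (l * σ) := by nlinarith
        nlinarith
      calc _ ≤ r * (l * (σ + u) ^ 2) := by gcongr
        _ = l * (r * (σ + u) ^ 2) := by ring
        _ ≤ _ := by gcongr
  have hE4 : ((Finset.univ.filter fun f => u ≤ σ ∧ A f < r * (σ - u) ^ 2).card : ℝ) ≤ N := by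
    by_cases huσ : u ≤ σ
    swap
    · simp [huσ, hN0]
    have hσp : 0 < σ := lt_of_lt_of_le hu huσ
    obtain ⟨l, hl⟩ : ∃ l, l = u / (2 * σ) := ⟨_, rfl⟩
    have hl0 : 0 < l := by rw [hl]; positivity
    have hl1 : l ≤ 1 := by rw [hl, div_le_one (by positivity)]; linarith
    have hlu : l * σ = u / 2 := by rw [hl]; field_simp
    refine tail_aux hn (fun i => -l * (x i - μ) ^ 2) (fun i => ?_) (-l * σ ^ 2) (u ^ 2 / 4)
      (u ^ 2 / 4) ?_ ?_ _ ?_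
    · rw [abs_mul, abs_neg, abs_of_pos hl0, abs_of_nonneg (sq_nonneg _)]
      nlinarith [hd2 i, sq_nonneg (x i - μ)]
    · rw [← Finset.mul_sum, hσ]; apply le_of_eq; ring
    · simp only [mul_pow, neg_sq]
      rw [← Finset.mul_sum]
      calc _ = l ^ 2 * (1 / (n : ℝ) * ∑ i, ((x i - μ) ^ 2) ^ 2) := by ring
        _ ≤ l ^ 2 * σ ^ 2 := by gcongr
        _ = u ^ 2 / 4 := by rw [← mul_pow, hlu]; ring
        _ ≤ _ := le_rfl
    · intro f hf
      have hf := (Finset.mem_filter.1 hf).2.2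
      rw [← Finset.mul_sum]
      change _ ≤ -l * A f
      have h1 : -l * σ ^ 2 + u ^ 2 / 4 + u ^ 2 / 4 ≤ -l * (σ - u) ^ 2 := by
        have : l * (σ - u) ^ 2 = l * σ ^ 2 - u ^ 2 + l * u ^ 2 := by
          linear_combination (-2 * u) * hlu
        have : l * u ≤ u / 2 := by nlinarith
        nlinarith
      calc _ ≤ r * (-l * (σ - u) ^ 2) := by gcongr
        _ = -(l * (r * (σ - u) ^ 2)) := by ring
        _ ≤ -(l * A f) := by gcongr
        _ = _ := by ring
  have hsub : B ⊆ ((Finset.univ.filter fun f => r * u < 1 * D f) ∪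
      (Finset.univ.filter fun f => r * u < (-1) * D f)) ∪
      ((Finset.univ.filter fun f => r * (σ + u) ^ 2 < A f) ∪
      (Finset.univ.filter fun f => u ≤ σ ∧ A f < r * (σ - u) ^ 2)) := by
    intro f hf
    have hf := hB f hf
    by_contra hcon
    simp only [Finset.mem_union, Finset.mem_filter, Finset.mem_univ, true_and, not_or, not_and,
      not_lt, one_mul] at hcon
    obtain ⟨⟨c1, c2⟩, c3, c4⟩ := hcon
    obtain ⟨d, hdd⟩ : ∃ d, d = D f / r := ⟨_, rfl⟩
    obtain ⟨a, haa⟩ : ∃ a, a = A f / r := ⟨_, rfl⟩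
    have hd1 : d ≤ u := by rw [hdd, div_le_iff₀ hr']; linarith
    have hd2 : -u ≤ d := by rw [hdd, le_div_iff₀ hr']; linarith
    have ha1 : a ≤ (σ + u) ^ 2 := by rw [haa, div_le_iff₀ hr']; linarith
    have ha2 : u ≤ σ → (σ - u) ^ 2 ≤ a := fun h => by
      rw [haa, le_div_iff₀ hr']; linarith [c4 h]
    have ha0 : 0 ≤ a := haa ▸ div_nonneg (hA0 f) hr'.le
    have hvar : (1 / (r : ℝ)) * ∑ i, (x (f i) - (1 / (r : ℝ)) * ∑ j, x (f j)) ^ 2 = a - d ^ 2 := by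
      have e1 : (1 / (r : ℝ)) * ∑ j, x (f j) = μ + d := by
        have : D f = ∑ j, x (f j) - r * μ := by simp [hD, Finset.sum_sub_distrib]
        rw [hdd, this]; field_simp; ring
      rw [e1]
      have e2 : ∑ i, (x (f i) - (μ + d)) ^ 2 = A f - 2 * d * D f + r * d ^ 2 := by
        have : ∀ i, (x (f i) - (μ + d)) ^ 2 =
            (x (f i) - μ) ^ 2 - 2 * d * (x (f i) - μ) + d ^ 2 := fun i => by ring
        simp only [this, Finset.sum_add_distrib, Finset.sum_sub_distrib, ← Finset.mul_sum]
        simp [hD, hA]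
      have e3 : D f = r * d := by rw [hdd]; field_simp
      have e4 : A f = r * a := by rw [haa]; field_simp
      rw [e2, e3, e4]; field_simp; ring
    have hvn : 0 ≤ a - d ^ 2 := by
      rw [← hvar]
      exact mul_nonneg (by positivity) (Finset.sum_nonneg fun i _ => sq_nonneg _)
    rw [hvar] at hf
    have hs0 := Real.sqrt_nonneg (a - d ^ 2)
    have hs1 := Real.sq_sqrt hvn
    have hdu : d ^ 2 ≤ u ^ 2 := sq_le_sq' hd2 hd1
    have hp0 := Real.sqrt_nonneg a
    have hp1 := Real.sq_sqrt ha0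
    have b1 : Real.sqrt a ≤ σ + u := Real.sqrt_le_iff.2 ⟨by positivity, ha1⟩
    have b2 : σ - u ≤ Real.sqrt a := by
      by_cases h : u ≤ σ
      · exact Real.le_sqrt_of_sq_le (ha2 h)
      · linarith
    have b3 : Real.sqrt (a - d ^ 2) ≤ Real.sqrt a := Real.sqrt_le_sqrt (by nlinarith)
    have b4 : Real.sqrt a ≤ Real.sqrt (a - d ^ 2) + u := by
      apply abs_le_of_sq_le_sq' _ (by positivity) |>.2
      nlinarith
    have : |σ - Real.sqrt (a - d ^ 2)| ≤ 2 * u := abs_le.2 ⟨by linarith, by linarith⟩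
    linarith
  have hc := (Finset.card_le_card hsub).trans ((Finset.card_union_le _ _).trans
    (add_le_add (Finset.card_union_le _ _) (Finset.card_union_le _ _)))
  have hc' := (Nat.cast_le (α := ℝ)).2 hc
  push_cast at hc'
  have g1 := hE12 1 (by simp)
  have g2 := hE12 (-1) (by simp)
  linarith

/-- **Concentration of the sample standard deviation under sampling without
replacement** (Theorem 2 of the paper).

There is an absolute constant `C > 0` such that for every finite population
`x : Fin n → ℝ` with values in `[0,1]` and every sample size `1 ≤ r ≤ n`,
if a sample of size `r` is drawn uniformly at random without replacement
(i.e. a uniformly random injection `f : Fin r ↪ Fin n`), then for every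
`δ ∈ (0,1/2)`, with probability at least `1 - 2δ`, the population standard
deviation `σ` and the sample standard deviation `σ̂` satisfy
`|σ - σ̂| ≤ C * sqrt (log (3/δ) / (2r))`. -/
theorem sample_stddev_concentration :
    ∃ C : ℝ, 0 < C ∧
      ∀ (n r : ℕ) [Nonempty (Fin r ↪ Fin n)], 1 ≤ r → r ≤ n →
        ∀ (x : Fin n → ℝ), (∀ i, x i ∈ Set.Icc (0 : ℝ) 1) →
          ∀ δ : ℝ, δ ∈ Set.Ioo (0 : ℝ) (1 / 2) →
            letI : MeasurableSpace (Fin r ↪ Fin n) := ⊤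
            ENNReal.ofReal (1 - 2 * δ) ≤
              (PMF.uniformOfFintype (Fin r ↪ Fin n)).toMeasure
                {f : Fin r ↪ Fin n |
                  |Real.sqrt ((1 / (n : ℝ)) *
                      ∑ i, (x i - (1 / (n : ℝ)) * ∑ j, x j) ^ 2) -
                    Real.sqrt ((1 / (r : ℝ)) *
                      ∑ i, (x (f i) - (1 / (r : ℝ)) * ∑ j, x (f j)) ^ 2)| ≤
                    C * Real.sqrt (Real.log (3 / δ) / (2 * (r : ℝ)))} := by
  refine ⟨6, by norm_num, ?_⟩
  intro n r _ hr1 hrn x hx δ hδ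
  obtain ⟨hδ0, hδ1⟩ := hδ
  letI : MeasurableSpace (Fin r ↪ Fin n) := ⊤
  classical
  have hr' : (0 : ℝ) < r := by exact_mod_cast hr1
  have hn : 0 < n := by omega
  have ht : 0 < Real.log (3 / δ) := Real.log_pos (by rw [lt_div_iff₀ hδ0]; linarith)
  set u : ℝ := 3 * Real.sqrt (Real.log (3 / δ) / (2 * (r : ℝ))) with hu
  have hu0 : 0 < u := by
    have : 0 < Real.sqrt (Real.log (3 / δ) / (2 * (r : ℝ))) := Real.sqrt_pos.2 (by positivity)
    positivity
  have hu2 : r * (u ^ 2 / 4) = 9 / 8 * Real.log (3 / δ) := by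
    rw [hu, mul_pow, Real.sq_sqrt (by positivity)]; field_simp; norm_num
  have hexp : Real.exp (-(r * (u ^ 2 / 4))) ≤ δ / 3 := by
    calc _ ≤ Real.exp (-Real.log (3 / δ)) := Real.exp_le_exp.2 (by rw [hu2]; linarith)
      _ = δ / 3 := by rw [Real.exp_neg, Real.exp_log (by positivity), inv_div]
  set G : Set (Fin r ↪ Fin n) := {f : Fin r ↪ Fin n |
                  |Real.sqrt ((1 / (n : ℝ)) *
                      ∑ i, (x i - (1 / (n : ℝ)) * ∑ j, x j) ^ 2) -
                    Real.sqrt ((1 / (r : ℝ)) *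
                      ∑ i, (x (f i) - (1 / (r : ℝ)) * ∑ j, x (f j)) ^ 2)| ≤
                    6 * Real.sqrt (Real.log (3 / δ) / (2 * (r : ℝ)))} with hG
  change ENNReal.ofReal (1 - 2 * δ) ≤ (PMF.uniformOfFintype (Fin r ↪ Fin n)).toMeasure G
  have hb := bad_card hn hr1 x hx u _ _ hu0 rfl (Real.sqrt_nonneg _)
    (Real.sq_sqrt (mul_nonneg (by positivity) (Finset.sum_nonneg fun i _ => sq_nonneg _)))
    (G.toFinset)ᶜ (by
      intro f hf
      simp only [Finset.mem_compl, Set.mem_toFinset, hG, Set.mem_ofPred_eq, not_le] at hf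
      rw [hu]
      linarith)
  have hN : (0 : ℝ) < Fintype.card (Fin r ↪ Fin n) := by exact_mod_cast Fintype.card_pos
  have hcard : (G.toFinset.card : ℝ) + ((G.toFinset)ᶜ.card : ℝ) =
      Fintype.card (Fin r ↪ Fin n) := by exact_mod_cast Finset.card_add_card_compl G.toFinset
  have hfin : (1 - 2 * δ) * Fintype.card (Fin r ↪ Fin n) ≤ (Fintype.card G : ℝ) := by
    rw [← Set.toFinset_card]
    have := mul_le_mul_of_nonneg_left hexp hN.le
    nlinarith [mul_pos hN hδ0]
  rw [PMF.toMeasure_uniformOfFintype_apply G MeasurableSpace.measurableSet_top]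
  have : ((Fintype.card G : ℕ) : ENNReal) / ((Fintype.card (Fin r ↪ Fin n) : ℕ) : ENNReal) =
      ENNReal.ofReal ((Fintype.card G : ℝ) / Fintype.card (Fin r ↪ Fin n)) := by
    rw [ENNReal.ofReal_div_of_pos hN, ENNReal.ofReal_natCast, ENNReal.ofReal_natCast]
  refine le_trans ?_ (le_of_eq (this.symm.trans ?_))
  · apply ENNReal.ofReal_le_ofReal
    rwa [le_div_iff₀ hN]
  · congr
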